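/- Let α be a finite type with cardinality p, let σ be a permutation of α with orbits of cardinalities ℓ_1, …, ℓ_m (so m = nc(σ), fixed points giving ℓ_j = 1), and set d = p − m. Then the number of d-tuples (τ_1, …, τ_d) of transpositions of α with τ_1 ∘ ⋯ ∘ τ_d = σ equals d! · (∏_{j=1}^{m} ℓ_j^{ℓ_j − 2}) / (∏_{j=1}^{m} (ℓ_j − 1)!), where the rational number ℓ^{ℓ−2} is interpreted as 1 when ℓ = 1. -/

import Mathlib

open Equiv Equiv.Perm Finset

lemma sum_range_neg_one_pow_choose_mul_pow {m : ℕ} (hm : 0 < m) :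
    ∑ i ∈ range (m + 1), (-1 : ℚ) ^ (m - i) * m.choose i * (i : ℚ) ^ (m - 1) = 0 := by
  have h := congrFun (fwdDiff_iter_pow_eq_zero_of_lt (R := ℚ) (Nat.sub_lt hm one_pos)) 0
  rw [fwdDiff_iter_eq_sum_shift] at h
  simpa using h

lemma sum_Icc_neg_one_pow_choose_mul_pow {m : ℕ} (hm : 0 < m) :
    ∑ i ∈ Icc 1 m, (-1 : ℚ) ^ (m - i) * m.choose i * (i : ℚ) ^ (m - 1) =
      if m = 1 then 1 else 0 := by
  have h := sum_range_neg_one_pow_choose_mul_pow hm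
  rw [range_eq_Ico, sum_eq_sum_Ico_succ_bot (by omega)] at h
  rw [← Ico_succ_right_eq_Icc, Order.succ_eq_add_one]
  split_ifs with h1
  · subst h1; simp
  · simpa [show m - 1 ≠ 0 by omega] using h

/-- A case of Abel's binomial identity. -/
lemma sum_choose_mul_pow_mul_pow {n : ℕ} (hn : 0 < n) :
    ∑ i ∈ Icc 1 n, (n.choose i : ℚ) * (i : ℚ) ^ (i - 1) * ((n - i : ℕ) : ℚ) ^ (n - i) =
      (n : ℚ) ^ n := by
  calc _ = ∑ i ∈ Icc 1 n, ∑ m ∈ Icc i n, (n : ℚ) ^ (n - m) * n.choose m *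
        ((-1 : ℚ) ^ (m - i) * m.choose i * (i : ℚ) ^ (m - 1)) := by
        refine sum_congr rfl fun i hi => ?_
        obtain ⟨hi1, hin⟩ := mem_Icc.1 hi
        have e : ((n - i : ℕ) : ℚ) = -(i : ℚ) + n := by push_cast [hin]; ring
        rw [e, add_pow, mul_sum, ← Ico_succ_right_eq_Icc, Order.succ_eq_add_one,
          sum_Ico_eq_sum_range, show n + 1 - i = n - i + 1 by omega]
        refine sum_congr rfl fun k hk => ?_
        have hk' : k ≤ n - i := by simpa [Nat.lt_succ_iff] using hk
        have hc : (n.choose (i + k) : ℚ) * (i + k).choose i = n.choose i * (n - i).choose k := by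
          have := Nat.choose_mul (n := n) (k := i + k) (s := i) (by omega)
          rw [Nat.add_sub_cancel_left] at this
          exact_mod_cast this
        rw [neg_pow, show i + k - i = k by omega, show n - i - k = n - (i + k) by omega,
          show i + k - 1 = (i - 1) + k by omega, pow_add]
        linear_combination (-(n : ℚ) ^ (n - (i + k)) * (-1) ^ k * (i : ℚ) ^ (i - 1) * i ^ k) * hc
    _ = ∑ m ∈ Icc 1 n, ∑ i ∈ Icc 1 m, (n : ℚ) ^ (n - m) * n.choose m *
        ((-1 : ℚ) ^ (m - i) * m.choose i * (i : ℚ) ^ (m - 1)) := by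
        refine sum_comm' fun i m => ?_
        simp only [mem_Icc]
        omega
    _ = ∑ m ∈ Icc 1 n, if m = 1 then (n : ℚ) ^ n else 0 := by
        refine sum_congr rfl fun m hm => ?_
        rw [← mul_sum, sum_Icc_neg_one_pow_choose_mul_pow (mem_Icc.1 hm).1]
        split_ifs with h1
        · obtain ⟨k, rfl⟩ := Nat.exists_eq_succ_of_ne_zero hn.ne'
          subst h1
          simp [pow_succ]
        · simp
    _ = (n : ℚ) ^ n := by
        rw [sum_ite_eq', if_pos (mem_Icc.2 ⟨le_rfl, hn⟩)]

/-- The weight `ℓ^(ℓ-2) / (ℓ-1)!` of a cycle of length `ℓ`. -/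
def cycleWeight (l : ℕ) : ℚ := (l : ℚ) ^ (l - 2) / ((l - 1).factorial : ℚ)

lemma factorial_mul_cycleWeight {l : ℕ} (hl : 0 < l) :
    (l.factorial : ℚ) * cycleWeight l = (l : ℚ) ^ (l - 1) := by
  obtain ⟨k, rfl⟩ := Nat.exists_eq_succ_of_ne_zero hl.ne'
  have := Nat.factorial_ne_zero k
  cases k with
  | zero => simp [cycleWeight]
  | succ k =>
    rw [cycleWeight, Nat.factorial_succ]
    simp
    field_simp
    ring

lemma sum_cycleWeight_mul_cycleWeight {l : ℕ} (hl : 0 < l) :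
    ∑ i ∈ Ico 1 l, cycleWeight i * cycleWeight (l - i) =
      2 * cycleWeight l * (1 - (l : ℚ)⁻¹) := by
  have hl0 : (l : ℚ) ≠ 0 := by positivity
  have hf : (l.factorial : ℚ) ≠ 0 := by positivity
  set T : ℚ := ∑ i ∈ Ico 1 l, (l.choose i : ℚ) * (i : ℚ) ^ (i - 1) * ((l - i : ℕ) : ℚ) ^ (l - i)
    with hT
  have hTval : T = (l : ℚ) ^ l - (l : ℚ) ^ (l - 1) := by
    have h := sum_choose_mul_pow_mul_pow hl
    rw [← Ico_succ_right_eq_Icc, Order.succ_eq_add_one, sum_Ico_succ_top hl] at h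
    simp at h
    linarith
  have hrefl : T = ∑ i ∈ Ico 1 l,
      (l.choose i : ℚ) * (i : ℚ) ^ i * ((l - i : ℕ) : ℚ) ^ (l - i - 1) := by
    rw [hT]
    refine sum_nbij' (fun i => l - i) (fun i => l - i) ?_ ?_ ?_ ?_ ?_ <;>
      intro i hi <;> simp only [mem_Ico] at hi ⊢ <;> try omega
    rw [Nat.choose_symm hi.2.le, show l - (l - i) = i by omega]
    ring
  have hterm : (l.factorial : ℚ) * l * ∑ i ∈ Ico 1 l, cycleWeight i * cycleWeight (l - i) =
      T + T := by
    conv_rhs => arg 1; rw [hrefl]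
    rw [hT, ← sum_add_distrib, mul_sum]
    refine sum_congr rfl fun i hi => ?_
    obtain ⟨h1, h2⟩ := mem_Ico.1 hi
    have hc : (l.choose i : ℚ) * i.factorial * (l - i).factorial = l.factorial := by
      exact_mod_cast Nat.choose_mul_factorial_mul_factorial h2.le
    have p1 : (i : ℚ) ^ i = i * i ^ (i - 1) := by rw [← pow_succ', Nat.sub_add_cancel h1]
    have p2 : ((l - i : ℕ) : ℚ) ^ (l - i) = ((l - i : ℕ) : ℚ) * ((l - i : ℕ) : ℚ) ^ (l - i - 1) := by
      rw [← pow_succ', Nat.sub_add_cancel (by omega)]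
    have e : (l : ℚ) = i + (l - i : ℕ) := by push_cast [h2.le]; ring
    rw [p1, p2, ← factorial_mul_cycleWeight h1, ← factorial_mul_cycleWeight (l := l - i) (by omega),
      ← hc]
    linear_combination ((l.choose i : ℚ) * i.factorial * (l - i).factorial * cycleWeight i *
      cycleWeight (l - i)) * e
  have hw := factorial_mul_cycleWeight hl
  have p : (l : ℚ) ^ l = l * l ^ (l - 1) := by rw [← pow_succ', Nat.sub_add_cancel hl]
  rw [hTval, p, ← hw] at hterm
  have : (l.factorial : ℚ) * l ≠ 0 := mul_ne_zero hf hl0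
  apply mul_left_cancel₀ this
  rw [hterm]
  field_simp
  ring

section PowApply

variable {α : Type*}

lemma pow_minimalPeriod_apply (σ : Perm α) (x : α) :
    (σ ^ Function.minimalPeriod σ x) x = x := by
  rw [← iterate_eq_pow]
  exact Function.iterate_minimalPeriod

lemma minimalPeriod_perm_pos [Finite α] (σ : Perm α) (x : α) : 0 < Function.minimalPeriod σ x :=
  Function.minimalPeriod_pos_of_mem_periodicPts
    ((Function.Injective.mem_periodicPts σ.injective) x)

lemma pow_apply_injOn (σ : Perm α) (x : α) :
    Set.InjOn (fun j : ℕ => (σ ^ j) x) (Set.Iio (Function.minimalPeriod σ x)) := by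
  simpa only [← iterate_eq_pow] using Function.iterate_injOn_Iio_minimalPeriod

lemma pow_apply_ne {σ : Perm α} {a : α} {j k : ℕ} (hj : j < Function.minimalPeriod σ a)
    (hk : k < Function.minimalPeriod σ a) (h : j ≠ k) : (σ ^ j) a ≠ (σ ^ k) a :=
  fun e => h (pow_apply_injOn σ a hj hk e)

lemma pow_swap_mul_apply [DecidableEq α] {σ : Perm α} {a b x : α} {k : ℕ}
    (h : ∀ j, 0 < j → j < k → (σ ^ j) x ≠ a ∧ (σ ^ j) x ≠ b) {j : ℕ} (hj : j < k) :
    ((swap a b * σ) ^ j) x = (σ ^ j) x := by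
  induction j with
  | zero => simp
  | succ j ih =>
    have := h (j + 1) j.succ_pos hj
    rw [pow_succ', mul_apply, ih (by omega), mul_apply, ← mul_apply σ, ← pow_succ',
      swap_apply_of_ne_of_ne this.1 this.2]

lemma pow_swap_mul_apply_last [DecidableEq α] {σ : Perm α} {a b x : α} {k : ℕ} (hk : 0 < k)
    (h : ∀ j, 0 < j → j < k → (σ ^ j) x ≠ a ∧ (σ ^ j) x ≠ b) :
    ((swap a b * σ) ^ k) x = swap a b ((σ ^ k) x) := by
  obtain ⟨k, rfl⟩ := Nat.exists_eq_succ_of_ne_zero hk.ne'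
  rw [pow_succ', mul_apply, pow_swap_mul_apply h k.lt_succ_self, mul_apply, ← mul_apply σ,
    ← pow_succ']

end PowApply

section Cycles

variable {α : Type*} [Fintype α] [DecidableEq α]

/-- The orbit of `x` under `σ`, as a finset. -/
def cycleClass (σ : Perm α) (x : α) : Finset α := {y | σ.SameCycle x y}

/-- The finset of all orbits of `σ`, fixed points included. -/
def cycleClasses (σ : Perm α) : Finset (Finset α) := univ.image (cycleClass σ)

lemma mem_cycleClass {σ : Perm α} {x y : α} : y ∈ cycleClass σ x ↔ σ.SameCycle x y := by
  simp [cycleClass]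

lemma self_mem_cycleClass (σ : Perm α) (x : α) : x ∈ cycleClass σ x :=
  mem_cycleClass.2 (SameCycle.refl σ x)

lemma cycleClass_eq_iff {σ : Perm α} {x y : α} :
    cycleClass σ x = cycleClass σ y ↔ σ.SameCycle x y := by
  refine ⟨fun h => mem_cycleClass.1 (h ▸ self_mem_cycleClass σ y), fun h => ?_⟩
  ext z
  exact ⟨fun hz => mem_cycleClass.2 (h.symm.trans (mem_cycleClass.1 hz)),
    fun hz => mem_cycleClass.2 (h.trans (mem_cycleClass.1 hz))⟩

lemma mem_cycleClasses {σ : Perm α} {S : Finset α} :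
    S ∈ cycleClasses σ ↔ ∃ x, cycleClass σ x = S := by
  simp [cycleClasses]

lemma eq_cycleClass_of_mem {σ : Perm α} {S : Finset α} (hS : S ∈ cycleClasses σ) {x : α}
    (hx : x ∈ S) : S = cycleClass σ x := by
  obtain ⟨y, rfl⟩ := mem_cycleClasses.1 hS
  exact cycleClass_eq_iff.2 (mem_cycleClass.1 hx)

lemma cycleClass_eq_image {σ : Perm α} {x : α} {k : ℕ} (hk : 0 < k) (hx : (σ ^ k) x = x) :
    cycleClass σ x = (range k).image (fun j => (σ ^ j) x) := by
  ext y
  simp only [mem_cycleClass, mem_image, mem_range]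
  constructor
  · intro h
    obtain ⟨n, -, -, rfl⟩ := h.exists_pow_eq''
    refine ⟨n % k, Nat.mod_lt _ hk, ?_⟩
    have hfix : ∀ m : ℕ, ((σ ^ k) ^ m) x = x := fun m => pow_apply_eq_self_of_apply_eq_self hx m
    conv_rhs => rw [← Nat.mod_add_div n k, pow_add, mul_apply, pow_mul, hfix]
  · rintro ⟨j, -, rfl⟩
    exact ⟨j, by simp⟩

lemma cycleClass_eq_image_minimalPeriod (σ : Perm α) (x : α) :
    cycleClass σ x = (range (Function.minimalPeriod σ x)).image (fun j => (σ ^ j) x) :=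
  cycleClass_eq_image (minimalPeriod_perm_pos σ x) (pow_minimalPeriod_apply σ x)

lemma card_cycleClass (σ : Perm α) (x : α) :
    #(cycleClass σ x) = Function.minimalPeriod σ x := by
  rw [cycleClass_eq_image_minimalPeriod, card_image_of_injOn, card_range]
  simpa using pow_apply_injOn σ x

lemma cycleClass_swap_mul_of_ne {σ : Perm α} {a b x : α} (ha : ¬ σ.SameCycle x a)
    (hb : ¬ σ.SameCycle x b) : cycleClass (swap a b * σ) x = cycleClass σ x := by
  have h (j : ℕ) : (σ ^ j) x ≠ a ∧ (σ ^ j) x ≠ b :=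
    ⟨fun e => ha ⟨j, by simpa using e⟩, fun e => hb ⟨j, by simpa using e⟩⟩
  have hpos := minimalPeriod_perm_pos σ x
  rw [cycleClass_eq_image_minimalPeriod σ, cycleClass_eq_image hpos]
  · exact image_congr fun j hj => pow_swap_mul_apply (fun j _ _ => h j) (by simpa using hj)
  · rw [pow_swap_mul_apply_last hpos (fun j _ _ => h j), swap_apply_of_ne_of_ne (h _).1 (h _).2,
      pow_minimalPeriod_apply]

lemma sameCycle_swap_mul_of_not_sameCycle {σ : Perm α} {a b : α} (h : ¬ σ.SameCycle a b) :
    (swap a b * σ).SameCycle a b := by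
  refine SameCycle.symm ⟨Function.minimalPeriod σ b, ?_⟩
  rw [zpow_natCast, pow_swap_mul_apply_last (minimalPeriod_perm_pos σ b),
    pow_minimalPeriod_apply, swap_apply_right]
  refine fun j hj hjk => ⟨fun e => h (SameCycle.symm ⟨j, by simpa using e⟩), fun e => ?_⟩
  exact hj.ne' (pow_apply_injOn σ b hjk (hj.trans hjk) (by simpa using e))

section Split

variable {σ : Perm α} {a : α} {i : ℕ}

lemma cycleClass_swap_mul_left (hi : 0 < i) (hil : i < Function.minimalPeriod σ a) :
    cycleClass (swap a ((σ ^ i) a) * σ) a = (range i).image (fun j => (σ ^ j) a) := by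
  have h : ∀ j, 0 < j → j < i → (σ ^ j) a ≠ a ∧ (σ ^ j) a ≠ (σ ^ i) a := fun j hj hji =>
    ⟨by simpa using pow_apply_ne (σ := σ) (a := a) (k := 0) (hji.trans hil) (by omega) hj.ne',
      pow_apply_ne (hji.trans hil) hil hji.ne⟩
  rw [cycleClass_eq_image hi]
  · exact image_congr fun j hj => pow_swap_mul_apply h (by simpa using hj)
  · rw [pow_swap_mul_apply_last hi h, swap_apply_right]

lemma cycleClass_swap_mul_right (hi : 0 < i) (hil : i < Function.minimalPeriod σ a) :
    cycleClass (swap a ((σ ^ i) a) * σ) ((σ ^ i) a) =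
      (Ico i (Function.minimalPeriod σ a)).image (fun j => (σ ^ j) a) := by
  set l := Function.minimalPeriod σ a with hl
  have h : ∀ j, 0 < j → j < l - i →
      (σ ^ j) ((σ ^ i) a) ≠ a ∧ (σ ^ j) ((σ ^ i) a) ≠ (σ ^ i) a := fun j hj hji => by
    rw [← mul_apply, ← pow_add]
    have h0 := pow_apply_ne (σ := σ) (a := a) (j := j + i) (k := 0) (by omega) (by omega) (by omega)
    exact ⟨by simpa using h0, pow_apply_ne (by omega) hil (by omega)⟩
  rw [cycleClass_eq_image (k := l - i) (by omega)]
  · rw [range_eq_Ico, image_congr (fun j hj => pow_swap_mul_apply h (by simpa using hj))]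
    ext y
    simp only [mem_image, mem_Ico, ← mul_apply, ← pow_add]
    constructor
    · rintro ⟨j, hj, rfl⟩
      exact ⟨j + i, by omega, rfl⟩
    · rintro ⟨j, hj, rfl⟩
      exact ⟨j - i, by omega, by rw [Nat.sub_add_cancel hj.1]⟩
  · rw [pow_swap_mul_apply_last (by omega) h, ← mul_apply (σ ^ _), ← pow_add,
      Nat.sub_add_cancel hil.le, hl, pow_minimalPeriod_apply, swap_apply_left]

lemma card_cycleClass_swap_mul_left (hi : 0 < i) (hil : i < Function.minimalPeriod σ a) :
    #(cycleClass (swap a ((σ ^ i) a) * σ) a) = i := by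
  rw [cycleClass_swap_mul_left hi hil, card_image_of_injOn, card_range]
  exact (pow_apply_injOn σ a).mono fun j hj => by
    simp only [coe_range, Set.mem_Iio] at hj ⊢; omega

lemma card_cycleClass_swap_mul_right (hi : 0 < i) (hil : i < Function.minimalPeriod σ a) :
    #(cycleClass (swap a ((σ ^ i) a) * σ) ((σ ^ i) a)) = Function.minimalPeriod σ a - i := by
  rw [cycleClass_swap_mul_right hi hil, card_image_of_injOn, Nat.card_Ico]
  exact (pow_apply_injOn σ a).mono fun j hj => by
    simp only [coe_Ico, Set.mem_Ico, Set.mem_Iio] at hj ⊢; omega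

lemma not_sameCycle_swap_mul (hi : 0 < i) (hil : i < Function.minimalPeriod σ a) :
    ¬ (swap a ((σ ^ i) a) * σ).SameCycle a ((σ ^ i) a) := by
  rw [← mem_cycleClass, cycleClass_swap_mul_left hi hil]
  simp only [mem_image, mem_range, not_exists, not_and]
  exact fun j hj => pow_apply_ne (hj.trans hil) hil hj.ne

lemma cycleClass_swap_mul_union (hi : 0 < i) (hil : i < Function.minimalPeriod σ a) :
    cycleClass (swap a ((σ ^ i) a) * σ) a ∪ cycleClass (swap a ((σ ^ i) a) * σ) ((σ ^ i) a) =
      cycleClass σ a := by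
  rw [cycleClass_swap_mul_left hi hil, cycleClass_swap_mul_right hi hil,
    cycleClass_eq_image_minimalPeriod σ a, ← image_union, range_eq_Ico, range_eq_Ico,
    Ico_union_Ico_eq_Ico hi.le hil.le]

lemma cycleClasses_swap_mul (hi : 0 < i) (hil : i < Function.minimalPeriod σ a) :
    cycleClasses (swap a ((σ ^ i) a) * σ) =
      insert (cycleClass (swap a ((σ ^ i) a) * σ) a)
        (insert (cycleClass (swap a ((σ ^ i) a) * σ) ((σ ^ i) a))
          ((cycleClasses σ).erase (cycleClass σ a))) := by
  have hab : σ.SameCycle a ((σ ^ i) a) := ⟨i, by simp⟩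
  have hne {x : α} (hx : ¬ σ.SameCycle x a) :
      cycleClass (swap a ((σ ^ i) a) * σ) x = cycleClass σ x :=
    cycleClass_swap_mul_of_ne hx fun h => hx (h.trans hab.symm)
  ext S
  simp only [mem_insert, mem_erase, mem_cycleClasses]
  constructor
  · rintro ⟨x, rfl⟩
    by_cases hx : σ.SameCycle x a
    · have hmem := mem_cycleClass.2 hx.symm
      rw [← cycleClass_swap_mul_union hi hil, mem_union, mem_cycleClass, mem_cycleClass,
        ← cycleClass_eq_iff, ← cycleClass_eq_iff] at hmem
      exact hmem.imp Eq.symm fun h => Or.inl h.symm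
    · rw [hne hx]
      exact Or.inr (Or.inr ⟨fun h => hx (cycleClass_eq_iff.1 h), x, rfl⟩)
  · rintro (rfl | rfl | ⟨hS, x, rfl⟩)
    · exact ⟨_, rfl⟩
    · exact ⟨_, rfl⟩
    · exact ⟨x, hne fun h => hS (cycleClass_eq_iff.2 h)⟩

lemma cycleClass_swap_mul_notMem (hi : 0 < i) (hil : i < Function.minimalPeriod σ a) :
    cycleClass (swap a ((σ ^ i) a) * σ) a ∉
      insert (cycleClass (swap a ((σ ^ i) a) * σ) ((σ ^ i) a))
        ((cycleClasses σ).erase (cycleClass σ a)) := by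
  rw [mem_insert, not_or, mem_erase, cycleClass_eq_iff]
  exact ⟨not_sameCycle_swap_mul hi hil, fun h =>
    h.1 (eq_cycleClass_of_mem h.2 (self_mem_cycleClass _ a))⟩

lemma cycleClass_swap_mul_notMem_erase (σ : Perm α) (a : α) (i : ℕ) :
    cycleClass (swap a ((σ ^ i) a) * σ) ((σ ^ i) a) ∉
      (cycleClasses σ).erase (cycleClass σ a) := by
  rw [mem_erase]
  refine fun h => h.1 ((eq_cycleClass_of_mem h.2 (self_mem_cycleClass _ _)).trans ?_)
  exact cycleClass_eq_iff.2 (SameCycle.symm ⟨i, by simp⟩)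

lemma prod_cycleClasses_swap_mul (g : ℕ → ℚ) (hi : 0 < i)
    (hil : i < Function.minimalPeriod σ a) :
    ∏ S ∈ cycleClasses (swap a ((σ ^ i) a) * σ), g #S =
      g i * g (Function.minimalPeriod σ a - i) *
        ∏ S ∈ (cycleClasses σ).erase (cycleClass σ a), g #S := by
  rw [cycleClasses_swap_mul hi hil, prod_insert (cycleClass_swap_mul_notMem hi hil),
    prod_insert (cycleClass_swap_mul_notMem_erase σ a i),
    card_cycleClass_swap_mul_left hi hil, card_cycleClass_swap_mul_right hi hil, mul_assoc]

lemma card_cycleClasses_swap_mul_pow (hi : 0 < i) (hil : i < Function.minimalPeriod σ a) :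
    #(cycleClasses (swap a ((σ ^ i) a) * σ)) = #(cycleClasses σ) + 1 := by
  have hmem : cycleClass σ a ∈ cycleClasses σ := mem_cycleClasses.2 ⟨a, rfl⟩
  rw [cycleClasses_swap_mul hi hil, card_insert_of_notMem (cycleClass_swap_mul_notMem hi hil),
    card_insert_of_notMem (cycleClass_swap_mul_notMem_erase σ a i), card_erase_add_one hmem]

end Split

lemma exists_pow_of_sameCycle {σ : Perm α} {a b : α} (hab : a ≠ b) (h : σ.SameCycle a b) :
    ∃ i, 0 < i ∧ i < Function.minimalPeriod σ a ∧ (σ ^ i) a = b := by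
  rw [← mem_cycleClass, cycleClass_eq_image_minimalPeriod] at h
  obtain ⟨i, hi, rfl⟩ := mem_image.1 h
  exact ⟨i, Nat.pos_of_ne_zero fun h0 => hab (by simp [h0]), mem_range.1 hi, rfl⟩

lemma card_cycleClasses_swap_mul_of_sameCycle {σ : Perm α} {a b : α} (hab : a ≠ b)
    (h : σ.SameCycle a b) :
    #(cycleClasses (swap a b * σ)) = #(cycleClasses σ) + 1 := by
  obtain ⟨i, hi, hil, rfl⟩ := exists_pow_of_sameCycle hab h
  exact card_cycleClasses_swap_mul_pow hi hil

lemma card_cycleClasses_swap_mul_of_not_sameCycle {σ : Perm α} {a b : α}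
    (h : ¬ σ.SameCycle a b) :
    #(cycleClasses (swap a b * σ)) + 1 = #(cycleClasses σ) := by
  have hab : a ≠ b := by rintro rfl; exact h (SameCycle.refl σ a)
  rw [← card_cycleClasses_swap_mul_of_sameCycle hab (sameCycle_swap_mul_of_not_sameCycle h),
    swap_mul_self_mul]

lemma card_cycleClasses_le (σ : Perm α) : #(cycleClasses σ) ≤ Fintype.card α :=
  card_image_le

lemma eq_one_of_card_cycleClasses {σ : Perm α} (h : #(cycleClasses σ) = Fintype.card α) :
    σ = 1 := by
  ext x
  have hinj := card_image_iff.1 h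
  exact (hinj (by simp) (by simp) (cycleClass_eq_iff.2 ⟨1, by simp⟩)).symm

lemma cycleClass_one (x : α) : cycleClass (1 : Perm α) x = {x} := by
  ext y
  simp [mem_cycleClass, eq_comm]

lemma card_cycleClasses_one : #(cycleClasses (1 : Perm α)) = Fintype.card α := by
  refine card_image_iff.2 fun x _ y _ h => ?_
  simpa [cycleClass_one] using h

lemma sum_inv_minimalPeriod (σ : Perm α) :
    ∑ a, (Function.minimalPeriod σ a : ℚ)⁻¹ = #(cycleClasses σ) := by
  rw [← sum_fiberwise_of_maps_to (s := univ) (t := cycleClasses σ) (g := cycleClass σ)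
    (fun a _ => mem_cycleClasses.2 ⟨a, rfl⟩), card_eq_sum_ones, Nat.cast_sum]
  refine sum_congr rfl fun S hS => ?_
  have hfib : ({a | cycleClass σ a = S} : Finset α) = S := by
    ext x
    simp only [mem_filter, mem_univ, true_and]
    exact ⟨fun h => h ▸ self_mem_cycleClass σ x, fun h => (eq_cycleClass_of_mem hS h).symm⟩
  rw [hfib, sum_congr rfl (g := fun _ => (#S : ℚ)⁻¹) fun a ha => by
    rw [← card_cycleClass, ← eq_cycleClass_of_mem hS ha]]
  obtain ⟨x, rfl⟩ := mem_cycleClasses.1 hS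
  have : (#(cycleClass σ x) : ℚ) ≠ 0 :=
    Nat.cast_ne_zero.2 (card_ne_zero_of_mem (self_mem_cycleClass σ x))
  simp [this]

end Cycles

section Factorizations

variable {α : Type*}

/-- The factorizations of `σ` into `n` transpositions. -/
abbrev SwapFactorization [DecidableEq α] (n : ℕ) (σ : Perm α) : Type _ :=
  {L : List (Perm α) // L.length = n ∧ (∀ τ ∈ L, τ.IsSwap) ∧ L.prod = σ}

variable [DecidableEq α]

instance [Finite α] (n : ℕ) (σ : Perm α) : Finite (SwapFactorization n σ) :=
  ((List.finite_length_eq (Perm α) n).subset fun _ hL => hL.1).to_subtype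

lemma card_swapFactorization_zero_one : Nat.card (SwapFactorization 0 (1 : Perm α)) = 1 := by
  rw [Nat.card_eq_one_iff_unique]
  refine ⟨⟨?_⟩, ⟨⟨[], by simp⟩⟩⟩
  rintro ⟨L, hL, -⟩ ⟨L', hL', -⟩
  simp [List.length_eq_zero_iff.1 hL, List.length_eq_zero_iff.1 hL']

lemma card_swapFactorization_zero_of_ne {σ : Perm α} (h : σ ≠ 1) :
    Nat.card (SwapFactorization 0 σ) = 0 := by
  have : IsEmpty (SwapFactorization 0 σ) := by
    refine ⟨?_⟩
    rintro ⟨L, hL, -, hprod⟩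
    rw [List.length_eq_zero_iff.1 hL] at hprod
    exact h hprod.symm
  exact Nat.card_of_isEmpty

lemma isSwap_mul_self {τ : Perm α} (h : τ.IsSwap) : τ * τ = 1 := by
  obtain ⟨x, y, -, rfl⟩ := h
  exact swap_mul_self x y

/-- Splitting off the first transposition. -/
def swapFactorizationSuccEquiv (n : ℕ) (σ : Perm α) :
    SwapFactorization (n + 1) σ ≃ Σ τ : {τ : Perm α // τ.IsSwap}, SwapFactorization n (τ.1 * σ) where
  toFun L := match L with
    | ⟨τ :: L, h⟩ => ⟨⟨τ, h.2.1 τ (by simp)⟩, L, by simpa using h.1,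
        fun ρ hρ => h.2.1 ρ (by simp [hρ]), by
          have hτ : τ.IsSwap := h.2.1 τ (by simp)
          have hprod : τ * L.prod = σ := by simpa using h.2.2
          change L.prod = τ * σ
          rw [← hprod, ← mul_assoc, isSwap_mul_self hτ, one_mul]⟩
  invFun L := ⟨L.1 :: L.2, by simp [L.2.2.1], by
    simpa using ⟨L.1.2, L.2.2.2.1⟩, by
    rw [List.prod_cons, L.2.2.2.2, ← mul_assoc, isSwap_mul_self L.1.2, one_mul]⟩
  left_inv L := match L with
    | ⟨τ :: L, h⟩ => rfl
  right_inv L := rfl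

variable [Fintype α]

instance : DecidablePred (IsSwap (α := α)) := fun τ =>
  inferInstanceAs (Decidable (∃ x y, x ≠ y ∧ τ = swap x y))

lemma card_swapFactorization_succ (n : ℕ) (σ : Perm α) :
    Nat.card (SwapFactorization (n + 1) σ) =
      ∑ τ : Perm α with τ.IsSwap, Nat.card (SwapFactorization n (τ * σ)) := by
  rw [Nat.card_congr (swapFactorizationSuccEquiv n σ), Nat.card_sigma]
  exact (sum_subtype _ (by simp) fun τ => Nat.card (SwapFactorization n (τ * σ))).symm

lemma filter_offDiag_swap_eq {x y : α} (hxy : x ≠ y) :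
    {p ∈ (univ : Finset α).offDiag | swap p.1 p.2 = swap x y} = {(x, y), (y, x)} := by
  ext ⟨a, b⟩
  simp only [mem_filter, mem_offDiag, mem_univ, true_and, mem_insert, mem_singleton, Prod.mk.injEq]
  constructor
  · rintro ⟨hab, h⟩
    have ha : swap x y a = b := by rw [← h, swap_apply_left]
    have hb : swap x y b = a := by rw [← h, swap_apply_right]
    grind
  · rintro (⟨rfl, rfl⟩ | ⟨rfl, rfl⟩)
    · exact ⟨hxy, rfl⟩
    · exact ⟨hxy.symm, swap_comm _ _⟩

lemma sum_offDiag_swap (f : Perm α → ℕ) :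
    ∑ p ∈ (univ : Finset α).offDiag, f (swap p.1 p.2) = 2 * ∑ τ : Perm α with τ.IsSwap, f τ := by
  rw [← sum_fiberwise_of_maps_to (t := {τ : Perm α | τ.IsSwap}) (g := fun p => swap p.1 p.2),
    mul_sum]
  · refine sum_congr rfl fun τ hτ => ?_
    obtain ⟨x, y, hxy, rfl⟩ := (mem_filter.1 hτ).2
    rw [sum_congr rfl (g := fun _ => f (swap x y)) fun p hp => by rw [(mem_filter.1 hp).2],
      sum_const, filter_offDiag_swap_eq hxy, card_pair (by simp [hxy]), smul_eq_mul]
  · intro p hp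
    simpa [swap_isSwap_iff] using hp

lemma two_mul_card_swapFactorization_succ (n : ℕ) (σ : Perm α) :
    2 * Nat.card (SwapFactorization (n + 1) σ) =
      ∑ a, ∑ b ∈ univ.erase a, Nat.card (SwapFactorization n (swap a b * σ)) := by
  rw [card_swapFactorization_succ,
    ← sum_offDiag_swap fun τ => Nat.card (SwapFactorization n (τ * σ))]
  refine sum_finset_product _ _ _ fun p => ?_
  simp [eq_comm]

lemma card_swapFactorization_eq_zero {n : ℕ} {σ : Perm α}
    (h : n + #(cycleClasses σ) < Fintype.card α) : Nat.card (SwapFactorization n σ) = 0 := by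
  induction n generalizing σ with
  | zero =>
    refine card_swapFactorization_zero_of_ne ?_
    rintro rfl
    simp [card_cycleClasses_one] at h
  | succ n ih =>
    rw [card_swapFactorization_succ]
    refine sum_eq_zero fun τ hτ => ih ?_
    obtain ⟨x, y, hxy, rfl⟩ := (mem_filter.1 hτ).2
    by_cases hs : σ.SameCycle x y
    · rw [card_cycleClasses_swap_mul_of_sameCycle hxy hs]
      omega
    · have := card_cycleClasses_swap_mul_of_not_sameCycle hs
      omega

lemma sum_erase_card_swapFactorization {n : ℕ} {σ : Perm α}
    (h : n + 1 + #(cycleClasses σ) = Fintype.card α) (a : α) :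
    ∑ b ∈ univ.erase a, Nat.card (SwapFactorization n (swap a b * σ)) =
      ∑ i ∈ Ico 1 (Function.minimalPeriod σ a),
        Nat.card (SwapFactorization n (swap a ((σ ^ i) a) * σ)) := by
  rw [← sum_subset (s₁ := (Ico 1 (Function.minimalPeriod σ a)).image fun i => (σ ^ i) a), sum_image]
  · intro i hi j hj
    exact pow_apply_injOn σ a (mem_Ico.1 hi).2 (mem_Ico.1 hj).2
  · intro b hb
    obtain ⟨i, hi, rfl⟩ := mem_image.1 hb
    obtain ⟨hi0, hil⟩ := mem_Ico.1 hi
    have := pow_apply_ne hil (minimalPeriod_perm_pos σ a) (by omega)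
    simpa using this
  · intro b hb hb'
    refine card_swapFactorization_eq_zero ?_
    have hs : ¬ σ.SameCycle a b := fun hs => hb' <| by
      obtain ⟨i, hi, hil, rfl⟩ := exists_pow_of_sameCycle (mem_erase.1 hb).1.symm hs
      exact mem_image.2 ⟨i, mem_Ico.2 ⟨hi, hil⟩, rfl⟩
    have := card_cycleClasses_swap_mul_of_not_sameCycle hs
    omega

/-- The number of minimal factorizations, as a product over the orbits. -/
theorem card_swapFactorization {n : ℕ} {σ : Perm α}
    (h : n + #(cycleClasses σ) = Fintype.card α) :
    (Nat.card (SwapFactorization n σ) : ℚ) =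
      n.factorial * ∏ S ∈ cycleClasses σ, cycleWeight #S := by
  induction n generalizing σ with
  | zero =>
    obtain rfl := eq_one_of_card_cycleClasses (by simpa using h)
    rw [card_swapFactorization_zero_one, prod_eq_one]
    · simp
    · intro S hS
      obtain ⟨x, rfl⟩ := mem_cycleClasses.1 hS
      simp [cycleClass_one, cycleWeight]
  | succ n ih =>
    set P := ∏ S ∈ cycleClasses σ, cycleWeight #S with hP
    have hterm (a : α) :
        ((∑ b ∈ univ.erase a, Nat.card (SwapFactorization n (swap a b * σ)) : ℕ) : ℚ) =
          2 * n.factorial * P * (1 - (Function.minimalPeriod σ a : ℚ)⁻¹) := by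
      have hprod : cycleWeight (Function.minimalPeriod σ a) *
          ∏ S ∈ (cycleClasses σ).erase (cycleClass σ a), cycleWeight #S = P := by
        rw [← card_cycleClass]
        exact mul_prod_erase _ (fun S => cycleWeight #S) (mem_cycleClasses.2 ⟨a, rfl⟩)
      rw [sum_erase_card_swapFactorization h, Nat.cast_sum, sum_congr rfl fun i hi => by
        obtain ⟨hi0, hil⟩ := mem_Ico.1 hi
        rw [ih (by rw [card_cycleClasses_swap_mul_pow hi0 hil]; omega),
          prod_cycleClasses_swap_mul cycleWeight hi0 hil],
        ← mul_sum, ← sum_mul, sum_cycleWeight_mul_cycleWeight (minimalPeriod_perm_pos σ a),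
        ← hprod]
      ring
    have hrec : (2 * Nat.card (SwapFactorization (n + 1) σ) : ℚ) =
        2 * n.factorial * P * (Fintype.card α - #(cycleClasses σ)) := by
      have := congrArg (Nat.cast (R := ℚ)) (two_mul_card_swapFactorization_succ n σ)
      rw [Nat.cast_sum, sum_congr rfl fun a _ => hterm a, ← mul_sum, sum_sub_distrib,
        sum_inv_minimalPeriod] at this
      simpa using this
    have hcard : (Fintype.card α : ℚ) = n + 1 + #(cycleClasses σ) := by exact_mod_cast h.symm
    rw [hcard] at hrec
    rw [Nat.factorial_succ]
    push_cast
    linear_combination hrec / 2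

end Factorizations


/-- The number of minimal factorizations of a permutation `σ` with orbits of
cardinalities `ℓ_1, …, ℓ_m` into `d = p - m` transpositions equals
`d! · ∏ ℓ_j^(ℓ_j - 2) / ∏ (ℓ_j - 1)!`. The orbits are encoded by a set `R` of
representatives, one per orbit, and `ℓ_r` is the cardinality of the orbit of
`r`. -/
theorem stmt14 {α : Type*} [Fintype α] [DecidableEq α] (σ : Equiv.Perm α)
    (R : Finset α) (hR : ∀ x : α, ∃! r, r ∈ R ∧ σ.SameCycle r x)
    (d : ℕ) (hd : d = Fintype.card α - R.card) :
    (Nat.card {L : List (Equiv.Perm α) //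
        L.length = d ∧ (∀ τ ∈ L, τ.IsSwap) ∧ L.prod = σ} : ℚ)
      = (d.factorial : ℚ)
        * (∏ r ∈ R, ((Set.ncard {x | σ.SameCycle r x} : ℚ))
            ^ (Set.ncard {x | σ.SameCycle r x} - 2))
        / (∏ r ∈ R, ((Set.ncard {x | σ.SameCycle r x} - 1).factorial : ℚ)) := by
  classical
  have hinj : Set.InjOn (cycleClass σ) R := fun r hr s hs h =>
    (hR s).unique ⟨hr, cycleClass_eq_iff.1 h⟩ ⟨hs, SameCycle.refl σ s⟩
  have himage : R.image (cycleClass σ) = cycleClasses σ := by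
    ext S
    simp only [mem_image, mem_cycleClasses]
    constructor
    · rintro ⟨r, -, rfl⟩
      exact ⟨r, rfl⟩
    · rintro ⟨x, rfl⟩
      obtain ⟨r, ⟨hr, hrx⟩, -⟩ := hR x
      exact ⟨r, hr, cycleClass_eq_iff.2 hrx⟩
  have hcard : #(cycleClasses σ) = #R := by rw [← himage, card_image_of_injOn hinj]
  have hncard (r : α) : Set.ncard {x | σ.SameCycle r x} = #(cycleClass σ r) := by
    rw [← Set.ncard_coe_finset]
    congr 1
    ext x
    simp [mem_cycleClass]
  have hle := card_cycleClasses_le σ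
  have hmain := card_swapFactorization (n := d) (σ := σ) (by omega)
  rw [← himage, prod_image hinj] at hmain
  simp only [hncard]
  rw [hmain, mul_div_assoc, ← prod_div_distrib]
  rfl
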